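/- arXiv:1411.4029 — 2 statements merged into one kernel-verified Lean document; each statement's English description precedes it below -/
import Mathlib

section
/- Let H be a connected four-cycle free graph. Then every configuration x ∈ X_H lifts to the universal cover: there exists x̃ ∈ X_{E_H} with π ∘ x̃ = x. Moreover the lift is unique once the value x̃_0 ∈ π^{-1}(x_0) is fixed. -/
abbrev Zd (d : ℕ) := Fin d → ℤ

def adjZ {d : ℕ} (i j : Zd d) : Prop := (∑ k, (i k - j k).natAbs) = 1

/-- The hom-shift `X_H`: graph homomorphisms from `ℤ^d` to `H`. -/
def homShift (d : ℕ) {V : Type*} (H : SimpleGraph V) : Set (Zd d → V) :=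
  {x | ∀ i j : Zd d, adjZ i j → H.Adj (x i) (x j)}

/-- `H` is four-cycle free: the 4-cycle `C_4` is not a subgraph of `H`. -/
def FourCycleFree {V : Type*} (H : SimpleGraph V) : Prop :=
  ∀ a b c e : V, H.Adj a b → H.Adj b c → H.Adj c e → H.Adj e a → a = c ∨ b = e

/-- A covering map of graphs. -/
def IsGraphCovering {W V : Type*} (T : SimpleGraph W) (H : SimpleGraph V)
    (p : W → V) : Prop :=
  (∀ a b : W, T.Adj a b → H.Adj (p a) (p b)) ∧
    ∀ w : W, Set.BijOn p (T.neighborSet w) (H.neighborSet (p w))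

/-- A property of lattice points that is invariant under each unit translation and holds at the
origin holds everywhere. -/
theorem Zd.forall_of_iff_add_single {d : ℕ} {P : Zd d → Prop} (h0 : P 0)
    (h : ∀ i k, P i ↔ P (i + Pi.single k 1)) (i : Zd d) : P i := by
  let periods : AddSubgroup (Zd d) :=
    { carrier := {v | ∀ i, P i ↔ P (i + v)}
      zero_mem' := fun i => by simp
      add_mem' := fun {a b} ha hb i => by rw [ha i, hb (i + a), add_assoc]
      neg_mem' := fun {a} ha i => by rw [ha (i + -a), neg_add_cancel_right] }
  have hmem : i ∈ periods := by
    rw [← Finset.univ_sum_single i]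
    refine sum_mem fun k _ => ?_
    have hk : (Pi.single k 1 : Zd d) ∈ periods := fun i => h i k
    have hs : (Pi.single k (i k) : Zd d) = i k • Pi.single k 1 := by
      rw [← Pi.single_smul, smul_eq_mul, mul_one]
    rw [hs]
    exact zsmul_mem hk _
  simpa using (hmem 0).1 h0

theorem adjZ_add_single {d : ℕ} (i : Zd d) (k : Fin d) : adjZ i (i + Pi.single k 1) := by
  unfold adjZ
  rw [Finset.sum_eq_single k]
  · simp
  · intro l _ hl
    simp [hl]
  · simp

theorem adjZ.eq_add_single {d : ℕ} {i j : Zd d} (h : adjZ i j) :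
    ∃ k, j = i + Pi.single k 1 ∨ i = j + Pi.single k 1 := by
  unfold adjZ at h
  obtain ⟨k, -, hk⟩ := Finset.exists_ne_zero_of_sum_ne_zero (h.trans_ne one_ne_zero)
  rw [← Finset.add_sum_erase _ _ (Finset.mem_univ k)] at h
  have hrest : ∑ l ∈ Finset.univ.erase k, (i l - j l).natAbs = 0 := by omega
  have hother : ∀ l, l ≠ k → i l = j l := fun l hlk => by
    have := Finset.sum_eq_zero_iff.1 hrest l (by simp [hlk])
    omega
  have hcases : j k = i k + 1 ∨ i k = j k + 1 := by omega
  refine ⟨k, hcases.imp (fun hc => ?_) (fun hc => ?_)⟩ <;> funext l <;>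
    by_cases hlk : l = k
  · subst hlk; simp [hc]
  · simp [hlk, hother l hlk]
  · subst hlk; simp [hc]
  · simp [hlk, hother l hlk]

/-- Pairwise commuting permutations generate an action of `ℤ^d`. -/
theorem exists_perm_of_commute {d : ℕ} {E : Type*} (S : Fin d → Equiv.Perm E)
    (hS : ∀ k l, Commute (S k) (S l)) :
    ∃ Ψ : Zd d → Equiv.Perm E, Ψ 0 = 1 ∧ ∀ i k, Ψ (i + Pi.single k 1) = S k * Ψ i := by
  have hcomm : Pairwise fun k l => ∀ a b : Multiplicative ℤ,
      Commute (zpowersHom _ (S k) a) (zpowersHom _ (S l) b) := fun k l _ a b => by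
    simpa using (hS k l).zpow_zpow _ _
  let Φ := MonoidHom.noncommPiCoprod (fun k => zpowersHom _ (S k)) hcomm
  refine ⟨fun i => Φ fun k => Multiplicative.ofAdd (i k), map_one Φ, fun i k => ?_⟩
  have hmul : (fun l => Multiplicative.ofAdd ((i + Pi.single k 1 : Zd d) l)) =
      Pi.mulSingle k (Multiplicative.ofAdd (1 : ℤ)) * fun l => Multiplicative.ofAdd (i l) := by
    funext l
    by_cases hlk : l = k
    · subst hlk
      simp [mul_comm]
    · simp [hlk]
  have hk : Φ (Pi.mulSingle k (Multiplicative.ofAdd (1 : ℤ))) = S k := by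
    simp [Φ, MonoidHom.noncommPiCoprod_mulSingle]
  simp only
  rw [hmul, map_mul, hk]

namespace IsGraphCovering

variable {W V : Type*} {T : SimpleGraph W} {H : SimpleGraph V} {p : W → V}

theorem eq_of_adj (hp : IsGraphCovering T H p) {w a b : W} (ha : T.Adj w a) (hb : T.Adj w b)
    (h : p a = p b) : a = b :=
  (hp.2 w).injOn ha hb h

theorem exists_adj (hp : IsGraphCovering T H p) {w : W} {v : V} (h : H.Adj (p w) v) :
    ∃ a, T.Adj w a ∧ p a = v :=
  (hp.2 w).surjOn h

/-- Two lifts of the sides of a four-cycle starting at the same vertex end at the same vertex. -/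
theorem eq_of_square (hp : IsGraphCovering T H p) (h4 : FourCycleFree H) {w a b a' b' : W}
    (ha : T.Adj w a) (hb : T.Adj a b) (ha' : T.Adj w a') (hb' : T.Adj a' b') (h : p b = p b') :
    b = b' := by
  have h3 : H.Adj (p b) (p a') := h ▸ (hp.1 _ _ hb').symm
  rcases h4 _ _ _ _ (hp.1 _ _ ha) (hp.1 _ _ hb) h3 (hp.1 _ _ ha').symm with hw | haa
  · rw [← hp.eq_of_adj ha.symm hb hw, hp.eq_of_adj ha'.symm hb' (hw.trans h)]
  · obtain rfl := hp.eq_of_adj ha ha' haa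
    exact hp.eq_of_adj hb hb' h

/-- Points of the pullback of a covering along `x` can be moved along each unit vector, and this
is invertible. -/
theorem exists_perm_pullback (hp : IsGraphCovering T H p) {d : ℕ} {x : Zd d → V}
    (hx : x ∈ homShift d H) (k : Fin d) :
    ∃ S : Equiv.Perm {e : Zd d × W // p e.2 = x e.1},
      ∀ e, (S e).1.1 = e.1.1 + Pi.single k 1 ∧ T.Adj e.1.2 (S e).1.2 := by
  have hadj (i : Zd d) : H.Adj (x i) (x (i + Pi.single k 1)) := hx _ _ (adjZ_add_single i k)
  have hstep : ∀ e : {e : Zd d × W // p e.2 = x e.1}, ∃ f : {e : Zd d × W // p e.2 = x e.1},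
      f.1.1 = e.1.1 + Pi.single k 1 ∧ T.Adj e.1.2 f.1.2 := by
    rintro ⟨⟨i, w⟩, hw⟩
    obtain ⟨a, ha, hpa⟩ := hp.exists_adj (w := w) (hw ▸ hadj i)
    exact ⟨⟨(i + Pi.single k 1, a), hpa⟩, rfl, ha⟩
  choose f hf using hstep
  refine ⟨Equiv.ofBijective f ⟨fun e e' h => ?_, fun e => ?_⟩, hf⟩
  · have h1 : e.1.1 = e'.1.1 := by
      have := (hf e).1.symm.trans ((congrArg (·.1.1) h).trans (hf e').1)
      exact add_right_cancel this
    have h2 := (hf e').2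
    rw [← h] at h2
    refine Subtype.ext (Prod.ext h1 (hp.eq_of_adj (hf e).2.symm h2.symm ?_))
    rw [e.2, e'.2, h1]
  · obtain ⟨⟨i, w⟩, hw⟩ := e
    have hi : H.Adj (p w) (x (i - Pi.single k 1)) := by
      have := (hadj (i - Pi.single k 1)).symm
      rwa [sub_add_cancel, ← hw] at this
    obtain ⟨a, ha, hpa⟩ := hp.exists_adj hi
    refine ⟨⟨(i - Pi.single k 1, a), hpa⟩, ?_⟩
    have h1 := (hf ⟨(i - Pi.single k 1, a), hpa⟩).1
    rw [sub_add_cancel] at h1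
    refine Subtype.ext (Prod.ext h1 (hp.eq_of_adj (hf _).2 ha.symm ?_))
    rw [(f _).2, h1, hw]

end IsGraphCovering

/-- Existence and uniqueness of lifts: for `H` connected and four-cycle free, with
universal cover (tree) `E_H` and covering map `π`, every `x ∈ X_H` lifts to
`x̃ ∈ X_{E_H}` with `π ∘ x̃ = x`, uniquely once `x̃ 0 ∈ π⁻¹(x 0)` is fixed. -/
theorem lift_exists_unique {d : ℕ} (hd : 2 ≤ d) {W V : Type*} [Fintype V]
    {H : SimpleGraph V} (hconn : H.Connected) (h4 : FourCycleFree H)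
    {T : SimpleGraph W} (hT : T.IsTree) (p : W → V) (hp : IsGraphCovering T H p) :
    ∀ x ∈ homShift d H, ∀ w0 : W, p w0 = x 0 →
      ∃! xt : Zd d → W, xt ∈ homShift d T ∧ (∀ i : Zd d, p (xt i) = x i) ∧ xt 0 = w0 := by
  intro x hx w0 hw0
  choose S hS using hp.exists_perm_pullback hx
  have hcomm : ∀ k l, Commute (S k) (S l) := fun k l => Equiv.ext fun e => by
    have h1 : (S k (S l e)).1.1 = (S l (S k e)).1.1 := by
      rw [(hS _ _).1, (hS _ _).1, (hS _ _).1, (hS _ _).1, add_right_comm]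
    refine Subtype.ext (Prod.ext h1 (hp.eq_of_square h4 (hS _ _).2 (hS _ _).2
      (hS _ _).2 (hS _ _).2 ?_))
    exact (S k (S l e)).2.trans ((congrArg x h1).trans (S l (S k e)).2.symm)
  obtain ⟨Ψ, hΨ0, hΨ⟩ := exists_perm_of_commute S hcomm
  let e0 : {e : Zd d × W // p e.2 = x e.1} := ⟨(0, w0), hw0⟩
  have hfst : ∀ i, (Ψ i e0).1.1 = i := Zd.forall_of_iff_add_single (by rw [hΨ0]; rfl)
    fun i k => by rw [hΨ, Equiv.Perm.mul_apply, (hS _ _).1, add_left_inj]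
  have hadj : ∀ i k, T.Adj (Ψ i e0).1.2 (Ψ (i + Pi.single k 1) e0).1.2 := fun i k => by
    rw [hΨ, Equiv.Perm.mul_apply]
    exact (hS _ _).2
  have hlift : ∀ i, p (Ψ i e0).1.2 = x i := fun i => by rw [(Ψ i e0).2, hfst]
  refine ⟨fun i => (Ψ i e0).1.2, ⟨fun i j hij => ?_, hlift, by simp [hΨ0, e0]⟩, ?_⟩
  · obtain ⟨k, rfl | rfl⟩ := hij.eq_add_single
    · exact hadj i k
    · exact (hadj j k).symm
  · rintro y ⟨hy, hpy, hy0⟩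
    refine funext (Zd.forall_of_iff_add_single (by simp [hΨ0, e0, hy0]) fun i k => ?_)
    have hyk := hy _ _ (adjZ_add_single i k)
    refine ⟨fun h => hp.eq_of_adj hyk (h ▸ hadj i k) ?_,
      fun h => hp.eq_of_adj hyk.symm (h ▸ (hadj i k).symm) ?_⟩
    · rw [hpy, hlift]
    · rw [hpy, hlift]
end

section
/- Let H be a connected four-cycle free graph and μ an ergodic shift-invariant measure on X_H with sl_{e_1} = 1 almost everywhere. Then μ is frozen (any two configurations in supp(μ) agreeing outside a finite set are equal) and the measure-theoretic entropy h_μ is zero. -/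
open Filter MeasureTheory

def unitVec (d : ℕ) (j : Fin d) : Zd d := fun k => if k = j then 1 else 0

def shiftZd (d : ℕ) {A : Type*} (v : Zd d) (x : Zd d → A) : Zd d → A :=
  fun i => x (i + v)

/-- The `l¹`-ball `D_n` of radius `n` around the origin in `ℤ^d`. -/
def ballD (d n : ℕ) : Set (Zd d) := {i | (∑ k, (i k).natAbs) ≤ n}

/-- The (topological) support of a measure. -/
def msupport {Ω : Type*} [TopologicalSpace Ω] [MeasurableSpace Ω] (μ : Measure Ω) :
    Set Ω := {x | ∀ U : Set Ω, IsOpen U → x ∈ U → 0 < μ U}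

/-- The Shannon entropy `H_μ^{D_n}` of `μ` with respect to the partition of the
configuration space into cylinder sets on `D_n`. -/
noncomputable def shannonD {d : ℕ} {V : Type*} [MeasurableSpace V]
    (μ : Measure (Zd d → V)) (n : ℕ) : ℝ :=
  ∑' a : (ballD d n → V),
    Real.negMulLog (μ {x : Zd d → V | ∀ i : ballD d n, x i.1 = a i}).toReal

namespace SimpleGraph

variable {W : Type*} {T : SimpleGraph W}

/-- In a tree, every vertex has at most one neighbour closer to a given root. -/
lemma IsTree.eq_of_adj_of_dist_succ (hT : T.IsTree) {r a b c : W} (hab : T.Adj a b)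
    (hcb : T.Adj c b) (ha : T.dist r b = T.dist r a + 1) (hc : T.dist r b = T.dist r c + 1) :
    a = c := by
  obtain ⟨P, hP⟩ := hT.connected.exists_walk_length_eq_dist r a
  obtain ⟨Q, hQ⟩ := hT.connected.exists_walk_length_eq_dist r c
  have hP' := (P.concat hab).isPath_of_length_eq_dist (by rw [Walk.length_concat, hP, ha])
  have hQ' := (Q.concat hcb).isPath_of_length_eq_dist (by rw [Walk.length_concat, hQ, hc])
  have key := congrArg (fun R : T.Path r b => R.1.penultimate)
    ((hT.isAcyclic.subsingleton_path r b).elim ⟨_, hP'⟩ ⟨_, hQ'⟩)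
  simpa using key

/-- A non-backtracking walk in a tree is a geodesic. -/
lemma IsTree.dist_of_nonbacktracking (hT : T.IsTree) {u : ℕ → W}
    (hadj : ∀ k, T.Adj (u k) (u (k + 1))) (hnb : ∀ k, u k ≠ u (k + 2)) (n : ℕ) :
    T.dist (u 0) (u n) = n := by
  suffices h : T.dist (u 0) (u n) = n ∧ T.dist (u 0) (u (n + 1)) = n + 1 from h.1
  induction n with
  | zero => simpa using SimpleGraph.dist_eq_one_iff_adj.2 (hadj 0)
  | succ n ih =>
    refine ⟨ih.2, ?_⟩
    rcases hT.dist_eq_dist_add_one_of_adj (u 0) (hadj (n + 1)) with h | h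
    · exact absurd (hT.eq_of_adj_of_dist_succ (r := u 0) (hadj n) (hadj (n + 1)).symm
        (by omega) h) (hnb n)
    · rw [h, ih.2]

/-- Non-backtracking walks in a tree are determined by their endpoints. -/
lemma IsTree.eq_of_nonbacktracking (hT : T.IsTree) {u v : ℕ → W}
    (hu : ∀ k, T.Adj (u k) (u (k + 1))) (hub : ∀ k, u k ≠ u (k + 2))
    (hv : ∀ k, T.Adj (v k) (v (k + 1))) (hvb : ∀ k, v k ≠ v (k + 2))
    (h0 : u 0 = v 0) {n : ℕ} (hn : u n = v n) : ∀ k ≤ n, u k = v k := by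
  induction n with
  | zero => intro k hk; obtain rfl : k = 0 := by omega
            exact h0
  | succ n ih =>
    have h1 := hT.dist_of_nonbacktracking hu hub
    have h2 := hT.dist_of_nonbacktracking hv hvb
    have hn' : u n = v n := by
      refine hT.eq_of_adj_of_dist_succ (r := u 0) (hu n) (hn ▸ hv n) (by rw [h1, h1]) ?_
      rw [h1, h0, h2]
    intro k hk
    rcases Nat.lt_or_ge k (n + 1) with h | h
    · exact ih hn' k (by omega)
    · obtain rfl : k = n + 1 := by omega
      exact hn

end SimpleGraph

lemma adjZ_comm {d : ℕ} {i j : Zd d} : adjZ i j ↔ adjZ j i := by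
  unfold adjZ
  simp_rw [fun k => show (i k - j k).natAbs = (j k - i k).natAbs by omega]

lemma adjZ_add_unitVec {d : ℕ} (i : Zd d) (k : Fin d) : adjZ i (i + unitVec d k) := by
  unfold adjZ
  rw [Finset.sum_eq_single k] <;> simp +contextual [unitVec]

lemma adjZ_sub_unitVec {d : ℕ} (i : Zd d) (k : Fin d) : adjZ i (i - unitVec d k) := by
  simpa using adjZ_comm.1 (adjZ_add_unitVec (i - unitVec d k) k)

lemma adjZ.exists_unitVec {d : ℕ} {i j : Zd d} (h : adjZ i j) :
    ∃ k, j = i + unitVec d k ∨ i = j + unitVec d k := by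
  unfold adjZ at h
  obtain ⟨k, hk⟩ : ∃ k, (i k - j k).natAbs ≠ 0 := by
    by_contra! hc
    simp [hc] at h
  have hsum := Finset.add_sum_erase Finset.univ (fun k => (i k - j k).natAbs) (Finset.mem_univ k)
  have h0 : ∑ l ∈ Finset.univ.erase k, (i l - j l).natAbs = 0 := by
    omega
  have hl : ∀ l, l ≠ k → i l = j l := fun l hl => by
    have := Finset.sum_eq_zero_iff.1 h0 l (by simp [hl])
    omega
  have hk1 : (i k - j k).natAbs = 1 := by omega
  refine ⟨k, ?_⟩
  rcases Int.natAbs_eq (i k - j k) with h1 | h1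
  · right
    ext l
    by_cases hlk : l = k
    · subst hlk; simp [unitVec]; omega
    · simp [unitVec, hlk, hl l hlk]
  · left
    ext l
    by_cases hlk : l = k
    · subst hlk; simp [unitVec]; omega
    · simp [unitVec, hlk, hl l hlk]

section Lifting

variable {d : ℕ} {W V : Type*} {H : SimpleGraph V} {T : SimpleGraph W} {p : W → V}

lemma IsGraphCovering.eq_of_adj_s17 (hp : IsGraphCovering T H p) {w a b : W} (ha : T.Adj w a)
    (hb : T.Adj w b) (hab : p a = p b) : a = b :=
  (hp.2 w).2.1 ha hb hab

lemma IsGraphCovering.exists_adj_s17 (hp : IsGraphCovering T H p) {w : W} {c : V}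
    (hc : H.Adj (p w) c) : ∃ a, T.Adj w a ∧ p a = c :=
  (hp.2 w).2.2 hc

lemma IsGraphCovering.surjective [Nonempty W] (hp : IsGraphCovering T H p)
    (hH : H.Connected) : Function.Surjective p := by
  intro c
  obtain ⟨w₀⟩ := ‹Nonempty W›
  have key : ∀ (a b : V) (_ : H.Walk a b) (w : W), p w = a → ∃ w', p w' = b := by
    intro a b P
    induction P with
    | nil => exact fun w hw => ⟨w, hw⟩
    | cons h _ ih =>
      intro w hw
      obtain ⟨a, -, ha⟩ := hp.exists_adj_s17 (hw ▸ h)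
      exact ih a ha
  exact key _ _ (hH.preconnected (p w₀) c).some w₀ rfl

/-- Going around a unit square in two different ways leads to the same lift. -/
lemma IsGraphCovering.eq_of_square_s17 (hp : IsGraphCovering T H p) (h4 : FourCycleFree H)
    {w a b ab ba : W} (ha : T.Adj w a) (hab : T.Adj a ab) (hb : T.Adj w b) (hba : T.Adj b ba)
    (he : p ab = p ba) : ab = ba := by
  rcases h4 (p w) (p a) (p ab) (p b) (hp.1 _ _ ha) (hp.1 _ _ hab)
    (he ▸ (hp.1 _ _ hba).symm) (hp.1 _ _ hb).symm with h | h
  · have h1 := hp.eq_of_adj_s17 ha.symm hab h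
    have h2 := hp.eq_of_adj_s17 hb.symm hba (h.trans he)
    rw [← h1, ← h2]
  · obtain rfl := hp.eq_of_adj_s17 ha hb h
    exact hp.eq_of_adj_s17 hab hba he

/-- For every coordinate direction, moving by one unit induces a permutation of the
pullback of the covering along a configuration. -/
lemma IsGraphCovering.exists_perm (hp : IsGraphCovering T H p) {x : Zd d → V}
    (hx : x ∈ homShift d H) (k : Fin d) :
    ∃ S : Equiv.Perm {e : Zd d × W // p e.2 = x e.1},
      ∀ e, (S e).1.1 = e.1.1 + unitVec d k ∧ T.Adj e.1.2 (S e).1.2 := by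
  have hf : ∀ e : {e : Zd d × W // p e.2 = x e.1}, ∃ e' : {e : Zd d × W // p e.2 = x e.1},
      e'.1.1 = e.1.1 + unitVec d k ∧ T.Adj e.1.2 e'.1.2 := fun e => by
    obtain ⟨a, ha, hpa⟩ := hp.exists_adj_s17 (w := e.1.2) (c := x (e.1.1 + unitVec d k))
      (by rw [e.2]; exact hx _ _ (adjZ_add_unitVec _ _))
    exact ⟨⟨(_, a), hpa⟩, rfl, ha⟩
  have hg : ∀ e : {e : Zd d × W // p e.2 = x e.1}, ∃ e' : {e : Zd d × W // p e.2 = x e.1},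
      e'.1.1 = e.1.1 - unitVec d k ∧ T.Adj e.1.2 e'.1.2 := fun e => by
    obtain ⟨a, ha, hpa⟩ := hp.exists_adj_s17 (w := e.1.2) (c := x (e.1.1 - unitVec d k))
      (by rw [e.2]; exact hx _ _ (adjZ_sub_unitVec _ _))
    exact ⟨⟨(_, a), hpa⟩, rfl, ha⟩
  choose f hf using hf
  choose g hg using hg
  refine ⟨⟨f, g, fun e => ?_, fun e => ?_⟩, hf⟩
  · have h1 : (g (f e)).1.1 = e.1.1 := by rw [(hg _).1, (hf _).1]; simp
    refine Subtype.ext (Prod.ext h1 (hp.eq_of_adj_s17 (hg (f e)).2 (hf e).2.symm ?_))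
    rw [(g (f e)).2, h1, e.2]
  · have h1 : (f (g e)).1.1 = e.1.1 := by rw [(hf _).1, (hg _).1]; simp
    refine Subtype.ext (Prod.ext h1 (hp.eq_of_adj_s17 (hf (g e)).2 (hg e).2.symm ?_))
    rw [(f (g e)).2, h1, e.2]

/-- Configurations in the hom-shift of a four-cycle free graph lift to its coverings. -/
lemma IsGraphCovering.exists_lift (hp : IsGraphCovering T H p) (h4 : FourCycleFree H)
    {x : Zd d → V} (hx : x ∈ homShift d H) (z : Zd d) {w : W} (hw : p w = x z) :
    ∃ xt ∈ homShift d T, (∀ i, p (xt i) = x i) ∧ xt z = w := by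
  choose S hS using fun k => hp.exists_perm hx k
  have hcomm : ∀ k l, Commute (S k) (S l) := fun k l => by
    refine Equiv.ext fun e => ?_
    have h1 : (S k (S l e)).1.1 = (S l (S k e)).1.1 := by
      simp only [(hS _ _).1]; abel
    refine Subtype.ext (Prod.ext h1 (hp.eq_of_square_s17 h4 (hS l e).2 (hS k _).2 (hS k e).2
      (hS l _).2 ?_))
    exact (S k (S l e)).2.trans ((congrArg x h1).trans (S l (S k e)).2.symm)
  let Φ : (Fin d → Multiplicative ℤ) →* Equiv.Perm {e : Zd d × W // p e.2 = x e.1} :=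
    MonoidHom.noncommPiCoprod (fun k => zpowersHom _ (S k)) (fun k l _ a b => by
      exact (hcomm k l).zpow_zpow a.toAdd b.toAdd)
  have hΦ1 : ∀ k, Φ (Pi.mulSingle k (Multiplicative.ofAdd 1)) = S k := fun k => by
    refine (MonoidHom.noncommPiCoprod_mulSingle _ _ _).trans ?_
    simp
  let K : Subgroup (Fin d → Multiplicative ℤ) :=
    { carrier := {v | ∀ e, (Φ v e).1.1 = e.1.1 + fun k => (v k).toAdd}
      one_mem' := fun e => by
        simp only [map_one, Equiv.Perm.one_apply]
        ext; simp
      mul_mem' := fun {a b} ha hb e => by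
        rw [map_mul, Equiv.Perm.mul_apply, ha, hb]
        ext; simp; ring
      inv_mem' := fun {a} ha e => by
        have := ha (Φ a⁻¹ e)
        rw [← Equiv.Perm.mul_apply, ← map_mul, mul_inv_cancel, map_one, Equiv.Perm.one_apply]
          at this
        rw [this]
        ext; simp }
  have hK : ∀ v, v ∈ K := fun v => by
    refine Subgroup.pi_mem_of_mulSingle_mem v fun k => ?_
    have h1 : Pi.mulSingle k (Multiplicative.ofAdd (1 : ℤ)) ∈ K := fun e => by
      rw [hΦ1, (hS k e).1]
      congr 1
      ext l
      by_cases h : l = k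
      · subst h; simp [unitVec]
      · simp [unitVec, h]
    have h2 : (Pi.mulSingle k (v k) : Fin d → Multiplicative ℤ)
        = Pi.mulSingle k (Multiplicative.ofAdd (1 : ℤ)) ^ (v k).toAdd := by
      rw [← Pi.mulSingle_zpow, ← ofAdd_zsmul]
      simp
    rw [h2]
    exact zpow_mem h1 _
  let xt : Zd d → W := fun i => (Φ (fun k => Multiplicative.ofAdd (i k - z k)) ⟨(z, w), hw⟩).1.2
  have hfst : ∀ i : Zd d,
      (Φ (fun k => Multiplicative.ofAdd (i k - z k)) ⟨(z, w), hw⟩).1.1 = i := fun i => by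
    rw [hK]; ext k; simp
  have hstep : ∀ (i : Zd d) k, T.Adj (xt i) (xt (i + unitVec d k)) := fun i k => by
    have : (fun l => Multiplicative.ofAdd ((i + unitVec d k) l - z l))
        = Pi.mulSingle k (Multiplicative.ofAdd (1 : ℤ)) *
          fun l => Multiplicative.ofAdd (i l - z l) := by
      ext l
      by_cases h : l = k
      · subst h; simp [unitVec]; ring
      · simp [unitVec, h]
    simp only [xt]
    rw [this, map_mul, hΦ1, Equiv.Perm.mul_apply]
    exact (hS k _).2
  refine ⟨xt, fun i j hij => ?_, fun i => ?_, ?_⟩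
  · obtain ⟨k, rfl | rfl⟩ := hij.exists_unitVec
    · exact hstep _ _
    · exact (hstep _ _).symm
  · simp only [xt]
    rw [(Φ (fun k => Multiplicative.ofAdd (i k - z k)) ⟨(z, w), hw⟩).2, hfst]
  · have : (fun k => Multiplicative.ofAdd (z k - z k)) = (1 : Fin d → Multiplicative ℤ) := by
      ext; simp
    simp only [xt]
    rw [this, map_one, Equiv.Perm.one_apply]

end Lifting

section Rigidity

variable {d : ℕ} {W V : Type*} {H : SimpleGraph V} {T : SimpleGraph W} {p : W → V}

/-- The configurations of the hom-shift which do not backtrack in the `k`-th coordinate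
direction. -/
def nonbacktrackingShift (H : SimpleGraph V) (k : Fin d) : Set (Zd d → V) :=
  {x | x ∈ homShift d H ∧ ∀ i, x i ≠ x (i + unitVec d k + unitVec d k)}

/-- If two lifts agree at the start of a straight segment along which the configurations agree,
then they agree at its end. -/
lemma IsGraphCovering.lift_eq_of_segment (hp : IsGraphCovering T H p) {x y : Zd d → V}
    {xt yt : Zd d → W} (hxt : xt ∈ homShift d T) (hyt : yt ∈ homShift d T)
    (hx : ∀ i, p (xt i) = x i) (hy : ∀ i, p (yt i) = y i) {a u : Zd d}
    (hu : ∀ i, adjZ i (i + u)) (ha : xt a = yt a) {n : ℕ}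
    (hxy : ∀ k ≤ n, x (a + k • u) = y (a + k • u)) : xt (a + n • u) = yt (a + n • u) := by
  induction n with
  | zero => simpa using ha
  | succ n ih =>
    have h1 := ih fun k hk => hxy k (by omega)
    have h2 : a + (n + 1) • u = a + n • u + u := by rw [succ_nsmul, add_assoc]
    have h3 := hxy (n + 1) le_rfl
    rw [h2] at h3 ⊢
    refine hp.eq_of_adj_s17 (hxt _ _ (hu (a + n • u))) (h1 ▸ hyt _ _ (hu (a + n • u))) ?_
    rw [hx, hy, h3]

/-- Two configurations without backtracking in direction `k₀` agree on a segment in that direction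
if they agree on the other three sides of a rectangle. -/
lemma IsGraphCovering.eq_on_segment (hp : IsGraphCovering T H p) (hT : T.IsTree)
    (h4 : FourCycleFree H) (hs : Function.Surjective p) {k₀ k₁ : Fin d} {x y : Zd d → V}
    (hx : x ∈ nonbacktrackingShift H k₀) (hy : y ∈ nonbacktrackingShift H k₀) (a : Zd d)
    {n m : ℕ}
    (h1 : ∀ k ≤ m, x (a + k • unitVec d k₁) = y (a + k • unitVec d k₁))
    (h2 : ∀ k ≤ n, x (a + m • unitVec d k₁ + k • unitVec d k₀)
      = y (a + m • unitVec d k₁ + k • unitVec d k₀))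
    (h3 : ∀ k ≤ m, x (a + n • unitVec d k₀ + k • unitVec d k₁)
      = y (a + n • unitVec d k₀ + k • unitVec d k₁)) :
    ∀ k ≤ n, x (a + k • unitVec d k₀) = y (a + k • unitVec d k₀) := by
  obtain ⟨w, hw⟩ := hs (x a)
  have hxya : x a = y a := by simpa using h1 0 (by omega)
  obtain ⟨xt, hxt, hpx, hxa⟩ := hp.exists_lift h4 hx.1 a hw
  obtain ⟨yt, hyt, hpy, hya⟩ := hp.exists_lift h4 hy.1 a (hw.trans hxya)
  have hadj := fun k i => adjZ_add_unitVec (d := d) i k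
  have hsub : ∀ i, adjZ i (i + -unitVec d k₁) := fun i => by
    rw [← sub_eq_add_neg]; exact adjZ_sub_unitVec i k₁
  have e1 := hp.lift_eq_of_segment hxt hyt hpx hpy (hadj k₁) (hxa.trans hya.symm) h1
  have e2 := hp.lift_eq_of_segment hxt hyt hpx hpy (hadj k₀) e1 h2
  have hrev : ∀ k ≤ m, a + m • unitVec d k₁ + n • unitVec d k₀ + k • (-unitVec d k₁)
      = a + n • unitVec d k₀ + (m - k) • unitVec d k₁ := fun k hk => by
    obtain ⟨l, rfl⟩ := Nat.exists_eq_add_of_le hk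
    rw [Nat.add_sub_cancel_left, smul_neg, add_smul]
    abel
  have e3 := hp.lift_eq_of_segment hxt hyt hpx hpy hsub e2 (n := m) fun k hk => by
    rw [hrev k hk]; exact h3 _ (by omega)
  rw [hrev m le_rfl, Nat.sub_self, zero_smul, add_zero] at e3
  have hsucc : ∀ k : ℕ, a + (k + 1) • unitVec d k₀ = a + k • unitVec d k₀ + unitVec d k₀ :=
    fun k => by rw [succ_nsmul, add_assoc]
  have hnb : ∀ (z : Zd d → V) (zt : Zd d → W), z ∈ nonbacktrackingShift H k₀ →
      (∀ i, p (zt i) = z i) →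
      ∀ k : ℕ, zt (a + k • unitVec d k₀) ≠ zt (a + (k + 2) • unitVec d k₀) := by
    intro z zt hz hpz k hk
    refine hz.2 (a + k • unitVec d k₀) ?_
    rw [← hpz, ← hpz, hk, hsucc (k + 1), hsucc k]
  intro k hk
  rw [← hpx, ← hpy]
  congr 1
  refine hT.eq_of_nonbacktracking (u := fun k => xt (a + k • unitVec d k₀))
    (v := fun k => yt (a + k • unitVec d k₀)) (fun k => ?_) (hnb x xt hx hpx) (fun k => ?_)
    (hnb y yt hy hpy) (by simpa using hxa.trans hya.symm) e3 k hk
  · simp only [hsucc]; exact hxt _ _ (hadj _ _)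
  · simp only [hsucc]; exact hyt _ _ (hadj _ _)

/-- The slice `{i | i k = c}` of the cube `[-n, n]^d`. -/
noncomputable def cubeSlice (n : ℕ) (k : Fin d) (c : ℤ) : Finset (Zd d) :=
  Fintype.piFinset (Function.update (fun _ => Finset.Icc (-n : ℤ) n) k {c})

lemma mem_cubeSlice {n : ℕ} {k : Fin d} {c : ℤ} {i : Zd d} :
    i ∈ cubeSlice n k c ↔ i k = c ∧ ∀ l ≠ k, i l ∈ Finset.Icc (-n : ℤ) n := by
  rw [cubeSlice, Fintype.mem_piFinset]
  constructor
  · intro h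
    refine ⟨by simpa using h k, fun l hl => by simpa [hl] using h l⟩
  · rintro ⟨h1, h2⟩ l
    by_cases hl : l = k
    · subst hl; simp [h1]
    · simpa [hl] using h2 l hl

lemma card_cubeSlice (n : ℕ) (k : Fin d) (c : ℤ) :
    (cubeSlice n k c).card = (2 * n + 1) ^ (d - 1) := by
  rw [cubeSlice, Fintype.card_piFinset, ← Finset.mul_prod_erase _ _ (Finset.mem_univ k)]
  have h : ∀ l ∈ Finset.univ.erase k,
      (Function.update (fun _ => Finset.Icc (-n : ℤ) n) k {c} l).card = 2 * n + 1 := by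
    intro l hl
    rw [Function.update_of_ne (Finset.ne_of_mem_erase hl), Int.card_Icc]
    omega
  rw [Finset.prod_congr rfl h]
  simp

/-- Three faces of the cube `[-n, n]^d`: both faces orthogonal to direction `k₀` and one face
orthogonal to direction `k₁`. -/
noncomputable def cubeFaces (n : ℕ) (k₀ k₁ : Fin d) : Finset (Zd d) :=
  cubeSlice n k₀ (-n) ∪ cubeSlice n k₀ n ∪ cubeSlice n k₁ n

lemma card_cubeFaces_le (n : ℕ) (k₀ k₁ : Fin d) :
    (cubeFaces n k₀ k₁).card ≤ 3 * (2 * n + 1) ^ (d - 1) := by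
  have h1 := Finset.card_union_le (cubeSlice n k₀ (-n) ∪ cubeSlice n k₀ n) (cubeSlice n k₁ n)
  have h2 := Finset.card_union_le (cubeSlice n k₀ (-n)) (cubeSlice n k₀ n)
  simp only [card_cubeSlice] at h1 h2
  unfold cubeFaces
  omega

/-- A configuration without backtracking is determined on a cube by its values on three faces. -/
lemma IsGraphCovering.eq_on_cube (hp : IsGraphCovering T H p) (hT : T.IsTree)
    (h4 : FourCycleFree H) (hs : Function.Surjective p) {k₀ k₁ : Fin d} (hk : k₀ ≠ k₁)
    {x y : Zd d → V} (hx : x ∈ nonbacktrackingShift H k₀) (hy : y ∈ nonbacktrackingShift H k₀)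
    {n : ℕ} (hxy : ∀ i ∈ cubeFaces n k₀ k₁, x i = y i) {i : Zd d}
    (hi : ∀ l, i l ∈ Finset.Icc (-n : ℤ) n) : x i = y i := by
  simp only [cubeFaces, Finset.mem_union, mem_cubeSlice] at hxy
  simp only [Finset.mem_Icc] at hi hxy
  have hi0 := hi k₀
  have hi1 := hi k₁
  set a : Zd d := Function.update i k₀ (-n) with ha
  set m : ℕ := (n - i k₁).toNat with hm
  have key := hp.eq_on_segment hT h4 hs (k₁ := k₁) hx hy a (n := 2 * n) (m := m) ?_ ?_ ?_
    (i k₀ + n).toNat (by omega)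
  · have : a + (i k₀ + n).toNat • unitVec d k₀ = i := by
      ext l
      by_cases hl : l = k₀
      · subst hl; simp [ha, unitVec]; omega
      · simp [ha, unitVec, hl]
    rwa [this] at key
  · intro k hk'
    refine hxy _ (Or.inl (Or.inl ⟨by simp [ha, unitVec, hk], fun l hl => ?_⟩))
    have := hi l
    by_cases hl1 : l = k₁
    · subst hl1; simp [ha, unitVec, hl]; omega
    · simp [ha, unitVec, hl, hl1]; omega
  · intro k hk'
    refine hxy _ (Or.inr ⟨by simp [ha, unitVec, hk.symm]; omega, fun l hl => ?_⟩)
    have := hi l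
    by_cases hl1 : l = k₀
    · subst hl1; simp [ha, unitVec, hl]; omega
    · simp [ha, unitVec, hl, hl1]; omega
  · intro k hk'
    refine hxy _ (Or.inl (Or.inr ⟨by simp [ha, unitVec, hk]; omega, fun l hl => ?_⟩))
    have := hi l
    by_cases hl1 : l = k₁
    · subst hl1; simp [ha, unitVec, hl]; omega
    · simp [ha, unitVec, hl, hl1]; omega

lemma natAbs_le_of_mem_ballD {n : ℕ} {i : Zd d} (hi : i ∈ ballD d n) (l : Fin d) :
    (i l).natAbs ≤ n :=
  (Finset.single_le_sum (f := fun k => (i k).natAbs) (fun _ _ => Nat.zero_le _)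
    (Finset.mem_univ l)).trans hi

/-- The set of configurations without backtracking is a frozen shift space. -/
lemma IsGraphCovering.eq_of_finite_ne (hp : IsGraphCovering T H p) (hT : T.IsTree)
    (h4 : FourCycleFree H) (hs : Function.Surjective p) {k₀ k₁ : Fin d} (hk : k₀ ≠ k₁)
    {x y : Zd d → V} (hx : x ∈ nonbacktrackingShift H k₀) (hy : y ∈ nonbacktrackingShift H k₀)
    (hfin : {i | x i ≠ y i}.Finite) : x = y := by
  ext i
  obtain ⟨B, hB⟩ := ((hfin.union (Set.finite_singleton i)).image
    fun j : Zd d => ∑ l, (j l).natAbs).bddAbove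
  have hB' : ∀ j, x j ≠ y j ∨ j = i → ∀ l, (j l).natAbs ≤ B := fun j hj l =>
    natAbs_le_of_mem_ballD (n := B) (hB ⟨j, hj, rfl⟩) l
  refine hp.eq_on_cube hT h4 hs hk hx hy (n := B + 1) (fun j hj => ?_) fun l => ?_
  · by_contra hne
    have h0 := hB' j (Or.inl hne) k₀
    have h1 := hB' j (Or.inl hne) k₁
    simp only [cubeFaces, Finset.mem_union, mem_cubeSlice] at hj
    rcases hj with (hj | hj) | hj <;> have := hj.1 <;> omega
  · have := hB' i (Or.inr rfl) l
    rw [Finset.mem_Icc]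
    omega

end Rigidity

section Entropy

variable {d : ℕ} {V : Type*}

lemma finite_ballD (d n : ℕ) : (ballD d n).Finite := by
  refine (Fintype.piFinset fun _ : Fin d => Finset.Icc (-n : ℤ) n).finite_toSet.subset
    fun i hi => ?_
  simp only [Finset.mem_coe, Fintype.mem_piFinset, Finset.mem_Icc]
  intro l
  have := natAbs_le_of_mem_ballD hi l
  omega

lemma pow_le_card_ballD (d n : ℕ) : n ^ d ≤ d ^ d * Nat.card (ballD d n) := by
  rcases Nat.eq_zero_or_pos d with rfl | hd
  · have : (ballD 0 n) = Set.univ := by ext; simp [ballD]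
    simp [this]
  have hsub : ((Fintype.piFinset fun _ : Fin d =>
      Finset.Icc (-(n / d : ℕ) : ℤ) (n / d : ℕ) : Finset (Zd d)) : Set (Zd d)) ⊆ ballD d n := by
    intro i hi
    simp only [Finset.mem_coe, Fintype.mem_piFinset, Finset.mem_Icc] at hi
    have : ∑ k, (i k).natAbs ≤ ∑ _k : Fin d, n / d :=
      Finset.sum_le_sum fun k _ => by have := hi k; omega
    refine this.trans ?_
    simpa using Nat.mul_div_le n d
  have hcard := Nat.card_mono (finite_ballD d n) hsub
  rw [Nat.card_coe_set_eq, Set.ncard_coe_finset, Fintype.card_piFinset] at hcard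
  simp only [Int.card_Icc, Finset.prod_const, Finset.card_univ, Fintype.card_fin] at hcard
  have h1 : n ≤ d * (2 * (n / d) + 1) := by
    exact (Nat.lt_mul_div_succ n hd).le.trans (Nat.mul_le_mul_left d (by omega))
  calc n ^ d ≤ (d * (2 * (n / d) + 1)) ^ d := Nat.pow_le_pow_left h1 d
    _ = d ^ d * (2 * (n / d) + 1) ^ d := mul_pow _ _ _
    _ ≤ _ := Nat.mul_le_mul_left _ (le_trans (le_of_eq (by congr 1; omega)) hcard)

/-- The entropy of a probability vector is at most the logarithm of the number of its entries. -/
lemma sum_negMulLog_le_log_card {ι : Type*} {s : Finset ι} {q : ι → ℝ} (hq : ∀ i ∈ s, 0 ≤ q i)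
    (hsum : ∑ i ∈ s, q i = 1) : ∑ i ∈ s, Real.negMulLog (q i) ≤ Real.log s.card := by
  have hs : s.Nonempty := by
    by_contra h
    rw [Finset.not_nonempty_iff_eq_empty] at h
    simp [h] at hsum
  have hc : (0 : ℝ) < s.card := by exact_mod_cast hs.card_pos
  have h := Real.concaveOn_negMulLog.le_map_sum (t := s) (w := fun _ => (s.card : ℝ)⁻¹) (p := q)
    (fun _ _ => by positivity) (by simp [hc.ne']) hq
  simp only [smul_eq_mul, ← Finset.mul_sum, hsum, mul_one] at h
  rw [Real.negMulLog, Real.log_inv, neg_mul_neg] at h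
  exact le_of_mul_le_mul_left h (by positivity)

lemma shannonD_nonneg [MeasurableSpace V] (μ : Measure (Zd d → V)) [IsProbabilityMeasure μ]
    (n : ℕ) : 0 ≤ shannonD μ n :=
  tsum_nonneg fun _ => Real.negMulLog_nonneg ENNReal.toReal_nonneg measureReal_le_one

/-- If almost every configuration is determined on a ball by its values on a finite set, then
the entropy of the ball is at most the entropy of a uniform configuration on this set. -/
lemma shannonD_le_of_determined [Fintype V] [MeasurableSpace V] [DiscreteMeasurableSpace V]
    (μ : Measure (Zd d → V)) [IsProbabilityMeasure μ] {Y : Set (Zd d → V)}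
    (hY : ∀ᵐ x ∂μ, x ∈ Y) {n : ℕ} {S : Finset (Zd d)}
    (hdet : ∀ x ∈ Y, ∀ y ∈ Y, (∀ i ∈ S, x i = y i) → ∀ i ∈ ballD d n, x i = y i) :
    shannonD μ n ≤ S.card * Real.log (Fintype.card V) := by
  classical
  have := (finite_ballD d n).fintype
  let r : (Zd d → V) → (ballD d n → V) := fun x i => x i
  have hr : Measurable r := measurable_pi_lambda _ fun i => measurable_pi_apply _
  have hcyl : ∀ a, {x : Zd d → V | ∀ i : ballD d n, x i.1 = a i} = r ⁻¹' {a} := fun a => by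
    ext x; simp [r, funext_iff]
  let P : Finset (ballD d n → V) := {a | ∃ x ∈ Y, r x = a}
  have hP : ∀ a, a ∈ P ↔ ∃ x ∈ Y, r x = a := fun a => by simp [P]
  have hsum : ∑ a ∈ P, μ.real (r ⁻¹' {a}) = 1 := by
    rw [sum_measureReal_preimage_singleton P fun a _ => hr (measurableSet_singleton a)]
    have : μ (r ⁻¹' P) = 1 := by
      rw [← mem_ae_iff_prob_eq_one (hr P.measurableSet)]
      filter_upwards [hY] with x hx using (hP _).2 ⟨x, hx, rfl⟩
    simp [measureReal_def, this]
  have hcard : P.card ≤ Fintype.card V ^ S.card := by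
    have : Nonempty (Zd d → V) := ⟨hY.exists.choose⟩
    choose! f hf using fun a => (hP a).1
    have := Finset.card_le_card_of_injOn (s := P) (t := (Finset.univ : Finset (S → V)))
      (fun a i => f a i) (fun _ _ => Finset.mem_univ _) (fun a ha b hb hab => by
        rw [← (hf a ha).2, ← (hf b hb).2]
        ext i
        exact hdet _ (hf a ha).1 _ (hf b hb).1 (fun i hi => congrFun hab ⟨i, hi⟩) i i.2)
    simpa using this
  have hPpos : 0 < P.card := by
    rw [Finset.card_pos]
    by_contra h
    rw [Finset.not_nonempty_iff_eq_empty] at h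
    simp [h] at hsum
  have hzero : ∀ a ∉ P, Real.negMulLog (μ.real (r ⁻¹' {a})) = 0 := fun a ha => by
    have : μ (r ⁻¹' {a}) = 0 := by
      refine measure_mono_null (fun x hx hxY => ha ((hP a).2 ⟨x, hxY, hx⟩)) hY
    simp [measureReal_def, this]
  calc shannonD μ n = ∑ a, Real.negMulLog (μ.real (r ⁻¹' {a})) := by
        simp only [shannonD, hcyl, tsum_fintype, measureReal_def]
    _ = ∑ a ∈ P, Real.negMulLog (μ.real (r ⁻¹' {a})) :=
        (Finset.sum_subset (Finset.subset_univ P) fun a _ ha => hzero a ha).symm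
    _ ≤ Real.log P.card := sum_negMulLog_le_log_card (fun _ _ => measureReal_nonneg) hsum
    _ ≤ Real.log ((Fintype.card V : ℝ) ^ S.card) :=
        Real.log_le_log (by exact_mod_cast hPpos) (by exact_mod_cast hcard)
    _ = S.card * Real.log (Fintype.card V) := Real.log_pow _ _

lemma tendsto_div_card_ballD_of_le {s : ℕ → ℝ} {L : ℝ} (hd : d ≠ 0) (hs : ∀ n, 0 ≤ s n)
    (hL : 0 ≤ L) (hle : ∀ n : ℕ, s n ≤ 3 * (2 * n + 1) ^ (d - 1) * L) :
    Tendsto (fun n => s n / (Nat.card (ballD d n) : ℝ)) atTop (nhds 0) := by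
  refine squeeze_zero' (Eventually.of_forall fun n => div_nonneg (hs n) (Nat.cast_nonneg _)) ?_
    (tendsto_const_div_atTop_nhds_zero_nat (3 * 3 ^ (d - 1) * L * d ^ d))
  filter_upwards [eventually_ge_atTop 1] with n hn
  have hn' : (1 : ℝ) ≤ n := by exact_mod_cast hn
  have hB : (n : ℝ) ^ d ≤ d ^ d * Nat.card (ballD d n) := by exact_mod_cast pow_le_card_ballD d n
  have hB0 : (0 : ℝ) < Nat.card (ballD d n) := by
    by_contra! h
    have : (0 : ℝ) < n ^ d := by positivity
    have : (d : ℝ) ^ d * Nat.card (ballD d n) ≤ 0 :=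
      mul_nonpos_of_nonneg_of_nonpos (by positivity) h
    linarith
  rw [div_le_div_iff₀ hB0 (by linarith)]
  calc s n * n ≤ 3 * (2 * n + 1) ^ (d - 1) * L * n := by gcongr; exact hle n
    _ ≤ 3 * (3 * n) ^ (d - 1) * L * n := by gcongr; linarith
    _ = 3 * 3 ^ (d - 1) * L * (n ^ (d - 1) * n) := by rw [mul_pow]; ring
    _ = 3 * 3 ^ (d - 1) * L * n ^ d := by rw [pow_sub_one_mul hd]
    _ ≤ 3 * 3 ^ (d - 1) * L * (d ^ d * Nat.card (ballD d n)) := by gcongr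
    _ = _ := by ring

end Entropy

section Slope

variable {d : ℕ} {W V : Type*} {H : SimpleGraph V} {T : SimpleGraph W} {p : W → V}

lemma measurable_shiftZd {V : Type*} [MeasurableSpace V] (v : Zd d) :
    Measurable (shiftZd d v : (Zd d → V) → (Zd d → V)) :=
  measurable_pi_lambda _ fun _ => measurable_pi_apply _

lemma measurableSet_homShift [Countable V] [MeasurableSpace V] [DiscreteMeasurableSpace V]
    (H : SimpleGraph V) : MeasurableSet (homShift d H) := by
  simp only [homShift, Set.ofPred_forall]
  refine MeasurableSet.iInter fun i => MeasurableSet.iInter fun j => MeasurableSet.iInter fun _ => ?_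
  have h : Measurable fun x : Zd d → V => (x i, x j) :=
    (measurable_pi_apply i).prodMk (measurable_pi_apply j)
  exact h (MeasurableSet.of_discrete (s := {q : V × V | H.Adj q.1 q.2}))

lemma isClosed_nonbacktrackingShift [TopologicalSpace V] [DiscreteTopology V]
    (H : SimpleGraph V) (k : Fin d) : IsClosed (nonbacktrackingShift H k) := by
  have h : ∀ i j, Continuous fun x : Zd d → V => (x i, x j) := fun i j =>
    (continuous_apply i).prodMk (continuous_apply j)
  refine IsClosed.inter (s₁ := homShift d H) ?_ ?_
  · simp only [homShift, Set.ofPred_forall]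
    refine isClosed_iInter fun i => isClosed_iInter fun j => isClosed_iInter fun _ => ?_
    exact (isClosed_discrete {q : V × V | H.Adj q.1 q.2}).preimage (h i j)
  · change IsClosed {x : Zd d → V | ∀ i, x i ≠ x (i + unitVec d k + unitVec d k)}
    simp only [Set.ofPred_forall]
    refine isClosed_iInter fun i => ?_
    exact (isClosed_discrete {q : V × V | q.1 ≠ q.2}).preimage (h i _)

lemma msupport_subset_of_ae {Ω : Type*} [TopologicalSpace Ω] [MeasurableSpace Ω]
    {μ : Measure Ω} {Y : Set Ω} (hY : IsClosed Y) (hμ : ∀ᵐ x ∂μ, x ∈ Y) : msupport μ ⊆ Y := by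
  intro x hx
  by_contra hxY
  exact (hx Yᶜ hY.isOpen_compl hxY).ne' hμ

open Classical in
/-- The indicator of the event that a configuration does not backtrack at the origin in
direction `k`. -/
noncomputable def forwardIndicator (k : Fin d) (x : Zd d → V) : ℝ :=
  if x 0 = x (unitVec d k + unitVec d k) then 0 else 1

lemma measurable_forwardIndicator [Countable V] [MeasurableSpace V] [DiscreteMeasurableSpace V]
    (k : Fin d) : Measurable (forwardIndicator k : (Zd d → V) → ℝ) := by
  classical
  have h : Measurable fun q : V × V => if q.1 = q.2 then (0 : ℝ) else 1 := Measurable.of_discrete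
  have h2 := h.comp ((measurable_pi_apply (X := fun _ : Zd d => V) (0 : Zd d)).prodMk
    (measurable_pi_apply (unitVec d k + unitVec d k)))
  convert h2 using 1
  ext x
  simp [forwardIndicator]

lemma forwardIndicator_nonneg (k : Fin d) (x : Zd d → V) : 0 ≤ forwardIndicator k x := by
  unfold forwardIndicator; split_ifs <;> norm_num

lemma forwardIndicator_le_one (k : Fin d) (x : Zd d → V) : forwardIndicator k x ≤ 1 := by
  unfold forwardIndicator; split_ifs <;> norm_num

/-- Each backtracking at an even position lowers the height reached along a line by two. -/
lemma IsGraphCovering.dist_le_sum_forwardIndicator (hp : IsGraphCovering T H p)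
    (hT : T.IsTree) {x : Zd d → V} {xt : Zd d → W} (hxt : xt ∈ homShift d T)
    (hx : ∀ i, p (xt i) = x i) (k : Fin d) (n : ℕ) :
    (T.dist (xt 0) (xt ((2 * n) • unitVec d k)) : ℝ) ≤
      2 * ∑ m ∈ Finset.range n, forwardIndicator k (shiftZd d ((2 * m) • unitVec d k) x) := by
  induction n with
  | zero => simp
  | succ n ih =>
    set b := (2 * n) • unitVec d k with hb
    have hb2 : (2 * (n + 1)) • unitVec d k = b + unitVec d k + unitVec d k := by
      rw [hb, mul_add, add_smul, mul_one, two_smul, add_assoc]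
    have htri := hT.connected.dist_triangle (u := xt 0) (v := xt b)
      (w := xt (b + unitVec d k + unitVec d k))
    have h1 := hxt _ _ (adjZ_add_unitVec b k)
    have h2 := hxt _ _ (adjZ_add_unitVec (b + unitVec d k) k)
    have hstep : (T.dist (xt b) (xt (b + unitVec d k + unitVec d k)) : ℝ) ≤
        2 * forwardIndicator k (shiftZd d b x) := by
      unfold forwardIndicator
      split_ifs with h
      · simp only [shiftZd, zero_add] at h
        rw [add_comm, ← add_assoc] at h
        rw [hp.eq_of_adj_s17 h1.symm h2 (by rw [hx, hx, h])]
        simp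
      · have h3 := hT.connected.dist_triangle (u := xt b) (v := xt (b + unitVec d k))
          (w := xt (b + unitVec d k + unitVec d k))
        rw [SimpleGraph.dist_eq_one_iff_adj.2 h1, SimpleGraph.dist_eq_one_iff_adj.2 h2] at h3
        rw [mul_one]
        exact_mod_cast h3
    have htri' : (T.dist (xt 0) (xt (b + unitVec d k + unitVec d k)) : ℝ) ≤
        T.dist (xt 0) (xt b) + T.dist (xt b) (xt (b + unitVec d k + unitVec d k)) := by
      exact_mod_cast htri
    rw [hb2, Finset.sum_range_succ, mul_add]
    linarith

/-- If the averages of translates of a function with values in `[0, 1]` tend to `1` almost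
everywhere, then the function is almost everywhere equal to `1`. -/
lemma ae_eq_one_of_tendsto_average {Ω : Type*} [MeasurableSpace Ω] {μ : Measure Ω}
    [IsProbabilityMeasure μ] {τ : ℕ → Ω → Ω} (hτ : ∀ n, MeasurePreserving (τ n) μ μ)
    {F : Ω → ℝ} (hF : Measurable F) (hF0 : ∀ x, 0 ≤ F x) (hF1 : ∀ x, F x ≤ 1)
    (hlim : ∀ᵐ x ∂μ, Tendsto (fun n : ℕ => (∑ m ∈ Finset.range n, F (τ m x)) / n) atTop
      (nhds 1)) : ∀ᵐ x ∂μ, F x = 1 := by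
  have h_int : ∀ m, Integrable (fun x => F (τ m x)) μ := fun m =>
    Integrable.of_bound (hF.comp (hτ m).measurable).aestronglyMeasurable 1
      (ae_of_all _ fun x => by rw [Real.norm_of_nonneg (hF0 _)]; exact hF1 _)
  have h_intF : Integrable F μ := Integrable.of_bound hF.aestronglyMeasurable 1
      (ae_of_all _ fun x => by rw [Real.norm_of_nonneg (hF0 _)]; exact hF1 _)
  have hτF : ∀ m, ∫ x, F (τ m x) ∂μ = ∫ x, F x ∂μ := fun m => by
    conv_rhs => rw [← (hτ m).map_eq]
    rw [integral_map (hτ m).measurable.aemeasurable hF.aestronglyMeasurable]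
  have hconv := tendsto_integral_of_dominated_convergence
    (F := fun n x => (∑ m ∈ Finset.range n, F (τ m x)) / n) (f := fun _ => (1 : ℝ)) (μ := μ)
    (fun _ => 1)
    (fun n => ((integrable_finsetSum _ fun m _ => h_int m).div_const _).aestronglyMeasurable)
    (integrable_const _)
    (fun n => ae_of_all _ fun x => by
      rw [Real.norm_of_nonneg (div_nonneg (Finset.sum_nonneg fun m _ => hF0 _)
        (Nat.cast_nonneg _))]
      refine div_le_one_of_le₀ ?_ (Nat.cast_nonneg _)
      simpa using Finset.sum_le_sum fun m (_ : m ∈ Finset.range n) => hF1 (τ m x)) hlim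
  have hconst : Tendsto (fun n : ℕ => ∫ x, (∑ m ∈ Finset.range n, F (τ m x)) / n ∂μ) atTop
      (nhds (∫ x, F x ∂μ)) := by
    refine tendsto_const_nhds.congr' ?_
    filter_upwards [eventually_ge_atTop 1] with n hn
    have hn' : (n : ℝ) ≠ 0 := by positivity
    rw [integral_div, integral_finsetSum _ fun m _ => h_int m]
    simp only [hτF, Finset.sum_const, Finset.card_range, nsmul_eq_mul]
    field_simp
  have heq : ∫ x, F x ∂μ = 1 := by
    have := tendsto_nhds_unique hconst hconv
    simpa using this
  have hzero : ∫ x, (1 - F x) ∂μ = 0 := by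
    rw [integral_sub (integrable_const _) h_intF, heq]
    simp
  have := (integral_eq_zero_iff_of_nonneg (fun x => sub_nonneg.2 (hF1 x))
    ((integrable_const _).sub h_intF)).1 hzero
  filter_upwards [this] with x hx
  simp only [Pi.zero_apply] at hx
  linarith

/-- If the height grows with slope one in direction `k` almost surely, then almost surely there
is no backtracking in this direction. -/
lemma IsGraphCovering.ae_mem_nonbacktrackingShift (hp : IsGraphCovering T H p)
    (hT : T.IsTree) (h4 : FourCycleFree H) (hs : Function.Surjective p) [Countable V]
    [MeasurableSpace V] [DiscreteMeasurableSpace V] (h : (Zd d → V) → Zd d → Zd d → ℕ)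
    (hheight : ∀ x ∈ homShift d H, ∀ xt ∈ homShift d T,
      (∀ i, p (xt i) = x i) → ∀ i j : Zd d, h x i j = T.dist (xt i) (xt j))
    {μ : Measure (Zd d → V)} [IsProbabilityMeasure μ] (hX : μ (homShift d H) = 1)
    (hinv : ∀ v : Zd d, Measure.map (shiftZd d v) μ = μ) (k : Fin d)
    (hslope : ∀ᵐ x ∂μ, Tendsto (fun n : ℕ => (h x 0 (n • unitVec d k) : ℝ) / n) atTop (nhds 1)) :
    ∀ᵐ x ∂μ, x ∈ nonbacktrackingShift H k := by
  have hX' : ∀ᵐ x ∂μ, x ∈ homShift d H :=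
    (mem_ae_iff_prob_eq_one (measurableSet_homShift H)).2 hX
  have hpres : ∀ v, MeasurePreserving (shiftZd d v : (Zd d → V) → _) μ μ := fun v =>
    ⟨measurable_shiftZd v, hinv v⟩
  have hF : ∀ᵐ x ∂μ, forwardIndicator k x = 1 := by
    refine ae_eq_one_of_tendsto_average (fun m => hpres ((2 * m) • unitVec d k))
      (measurable_forwardIndicator k) (forwardIndicator_nonneg k) (forwardIndicator_le_one k) ?_
    filter_upwards [hX', hslope] with x hx hsl
    obtain ⟨w, hw⟩ := hs (x 0)
    obtain ⟨xt, hxt, hpx, -⟩ := hp.exists_lift h4 hx 0 hw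
    have hsub := hsl.comp (tendsto_id.const_mul_atTop' (r := 2) (by norm_num))
    refine tendsto_of_tendsto_of_tendsto_of_le_of_le' hsub tendsto_const_nhds ?_ ?_
    · filter_upwards [eventually_ge_atTop 1] with n hn
      have hn' : (0 : ℝ) < n := by exact_mod_cast hn
      have := hp.dist_le_sum_forwardIndicator hT hxt hpx k n
      simp only [Function.comp_apply, id_eq, hheight x hx xt hxt hpx]
      push_cast
      rw [div_le_div_iff₀ (by positivity) hn']
      nlinarith
    · refine Eventually.of_forall fun n => div_le_one_of_le₀ ?_ (Nat.cast_nonneg _)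
      simpa using Finset.sum_le_sum fun m (_ : m ∈ Finset.range n) =>
        forwardIndicator_le_one k (shiftZd d ((2 * m) • unitVec d k) x)
  have hall : ∀ᵐ x ∂μ, ∀ i, forwardIndicator k (shiftZd d i x) = 1 :=
    ae_all_iff.2 fun i => (hpres i).quasiMeasurePreserving.ae hF
  filter_upwards [hX', hall] with x hx hi
  refine ⟨hx, fun i hback => ?_⟩
  have := hi i
  rw [forwardIndicator, if_pos] at this
  · norm_num at this
  · simp only [shiftZd, zero_add]
    rw [hback, add_assoc, add_comm]

end Slope

/-- If the slope in direction `e₁` of an ergodic shift-invariant measure `μ` on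
`X_H` is `1` a.e., then `μ` is frozen and has zero measure-theoretic entropy. -/
theorem slope_one_frozen_zero_entropy {d : ℕ} (hd : 2 ≤ d) {W V : Type*}
    [Fintype V] [MeasurableSpace V] [DiscreteMeasurableSpace V]
    [TopologicalSpace V] [DiscreteTopology V]
    {H : SimpleGraph V} (hconn : H.Connected) (h4 : FourCycleFree H)
    {T : SimpleGraph W} (hT : T.IsTree) (p : W → V) (hp : IsGraphCovering T H p)
    (h : (Zd d → V) → Zd d → Zd d → ℕ)
    (hheight : ∀ x ∈ homShift d H, ∀ xt ∈ homShift d T,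
      (∀ i, p (xt i) = x i) → ∀ i j : Zd d, h x i j = T.dist (xt i) (xt j))
    (μ : Measure (Zd d → V)) [IsProbabilityMeasure μ]
    (hX : μ (homShift d H) = 1)
    (hinv : ∀ v : Zd d, Measure.map (shiftZd d v) μ = μ)
    (herg : ∀ s : Set (Zd d → V), MeasurableSet s →
      (∀ v : Zd d, shiftZd d v ⁻¹' s = s) → μ s = 0 ∨ μ s = 1)
    (hslope : ∀ᵐ x ∂μ,
      Tendsto (fun n : ℕ => (h x 0 (n • unitVec d ⟨0, by omega⟩) : ℝ) / n)
        atTop (nhds 1)) :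
    (∀ x ∈ msupport μ, ∀ y ∈ msupport μ, {i : Zd d | x i ≠ y i}.Finite → x = y) ∧
    Tendsto (fun n : ℕ => shannonD μ n / (Nat.card (ballD d n) : ℝ))
      atTop (nhds 0) := by
  have := hT.connected.nonempty
  have hs := hp.surjective hconn
  have hk : (⟨0, by omega⟩ : Fin d) ≠ ⟨1, by omega⟩ := by simp
  have hY := hp.ae_mem_nonbacktrackingShift hT h4 hs h hheight hX hinv _ hslope
  have hsupp := msupport_subset_of_ae (isClosed_nonbacktrackingShift H _) hY
  refine ⟨fun x hx y hy hfin => hp.eq_of_finite_ne hT h4 hs hk (hsupp hx) (hsupp hy) hfin, ?_⟩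
  refine tendsto_div_card_ballD_of_le (by omega) (shannonD_nonneg μ)
    (Real.log_natCast_nonneg (Fintype.card V)) fun n => ?_
  refine (shannonD_le_of_determined μ hY (S := cubeFaces n ⟨0, by omega⟩ ⟨1, by omega⟩)
    fun x hx y hy hxy i hi => hp.eq_on_cube hT h4 hs hk hx hy hxy fun l => ?_).trans ?_
  · have := natAbs_le_of_mem_ballD hi l
    rw [Finset.mem_Icc]
    omega
  · refine mul_le_mul_of_nonneg_right ?_ (Real.log_natCast_nonneg _)
    exact_mod_cast card_cubeFaces_le n _ _
end
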